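/- Given a feasible solution x0 of min{wx : Ax = b, l <= x <= u, x ∈ Z^n} with a finite optimum, the Graver-best augmentation procedure terminates in at most (2n - 2) log F iterations, where F = w x0 - w x* and x* is any minimizer: each Graver-best step decreases the objective gap to the optimum by a factor of at least (1 - 1/(2n - 2)). -/

import Mathlib

/-- The conformal (sign-compatible) partial order on `ℤ^n`. -/
def ConformalLE {n : ℕ} (x y : Fin n → ℤ) : Prop :=
  ∀ i, 0 ≤ x i * y i ∧ |x i| ≤ |y i|

/-- The Graver basis of an integer `m × n` matrix `A`. -/
def GraverBasis {m n : ℕ} (A : Matrix (Fin m) (Fin n) ℤ) : Set (Fin n → ℤ) :=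
  {g | A.mulVec g = 0 ∧ g ≠ 0 ∧
    ∀ h : Fin n → ℤ, A.mulVec h = 0 → h ≠ 0 → ConformalLE h g → h = g}

/-- Feasibility for `{Ax = b, l ≤ x ≤ u}` with bounds in `ℤ ∪ {±∞}` (via `EReal`). -/
def Feasible {m n : ℕ} (A : Matrix (Fin m) (Fin n) ℤ) (b : Fin m → ℤ)
    (l u : Fin n → EReal) (x : Fin n → ℤ) : Prop :=
  A.mulVec x = b ∧ ∀ i, l i ≤ ((x i : ℝ) : EReal) ∧ ((x i : ℝ) : EReal) ≤ u i

/-- `h` is a Graver-best step for the feasible solution `x`: a feasible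
augmenting step whose objective value is at most that of `x + λg` for every
`x`-feasible step pair `(g, λ) ∈ G(A) × ℤ`. -/
def GraverBestStep {m n : ℕ} (A : Matrix (Fin m) (Fin n) ℤ) (w : Fin n → ℤ)
    (b : Fin m → ℤ) (l u : Fin n → EReal) (x h : Fin n → ℤ) : Prop :=
  Feasible A b l u (x + h) ∧ (∑ i, w i * (x + h) i) < ∑ i, w i * x i ∧
    ∀ g ∈ GraverBasis A, ∀ lam : ℤ, Feasible A b l u (x + lam • g) →
      ∑ i, w i * (x + h) i ≤ ∑ i, w i * (x + lam • g) i

theorem lp_vertex {ι : Type*} [Fintype ι] {n : ℕ} (v : ι → Fin n → ℝ) (d : Fin n → ℝ) (B : ℝ)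
    (hne : ∃ a : ι → ℝ, (∀ i, 0 ≤ a i) ∧ ∑ i, a i • v i = d)
    (hB : ∀ a : ι → ℝ, (∀ i, 0 ≤ a i) → ∑ i, a i • v i = d → ∀ i, a i ≤ B) :
    ∃ a : ι → ℝ, (∀ i, 0 ≤ a i) ∧ ∑ i, a i • v i = d ∧
      (∀ a' : ι → ℝ, (∀ i, 0 ≤ a' i) → ∑ i, a' i • v i = d → ∑ i, a' i ≤ ∑ i, a i) ∧
      LinearIndependent ℝ (fun i : {i // a i ≠ 0} => v i) := by
  classical
  let P : Set (ι → ℝ) := {a | (∀ i, 0 ≤ a i) ∧ ∑ i, a i • v i = d}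
  have hPc : IsCompact P := by
    apply IsCompact.of_isClosed_subset (isCompact_Icc (a := fun _ : ι => (0:ℝ)) (b := fun _ => B))
    · have h1 : IsClosed {a : ι → ℝ | ∀ i, 0 ≤ a i} := by
        simp only [Set.ofPred_forall]
        exact isClosed_iInter fun i => isClosed_le continuous_const (continuous_apply i)
      have h2 : IsClosed {a : ι → ℝ | ∑ i, a i • v i = d} :=
        isClosed_eq (by fun_prop) continuous_const
      exact h1.inter h2
    · intro a ha
      exact ⟨fun i => ha.1 i, fun i => hB a ha.1 ha.2 i⟩
  obtain ⟨a0, ha0, hmax0⟩ := hPc.exists_isMaxOn (f := fun a : ι → ℝ => ∑ i, a i) hne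
    (by fun_prop)
  let Q : Set (ι → ℝ) := {a | a ∈ P ∧ ∀ a' ∈ P, ∑ i, a' i ≤ ∑ i, a i}
  have hQ : Q.Nonempty := ⟨a0, ha0, fun a' h => hmax0 h⟩
  obtain ⟨a, haQ, hmin⟩ := exists_minimalFor_of_wellFoundedLT (fun a => a ∈ Q)
    (fun a : ι → ℝ => (Finset.univ.filter (fun i => a i ≠ 0)).card) hQ
  have key : ∀ c : ι → ℝ, (∀ i, a i = 0 → c i = 0) → ∑ i, c i • v i = 0 → 0 ≤ ∑ i, c i →
      c = 0 := by
    intro c hc hcv hs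
    have hadd : ∀ t : ℝ, ∑ i, (a i + t * c i) • v i = d := by
      intro t
      simp only [add_smul, mul_smul, Finset.sum_add_distrib, ← Finset.smul_sum, hcv, haQ.1.2]
      simp
    have hsum : ∀ t : ℝ, ∑ i, (a i + t * c i) = ∑ i, a i + t * ∑ i, c i := by
      intro t
      rw [Finset.sum_add_distrib, Finset.mul_sum]
    have hnn : ∀ i, 0 ≤ c i := by
      by_contra! hneg
      obtain ⟨j, hj⟩ := hneg
      obtain ⟨k, hk, hkmin⟩ := Finset.exists_min_image (Finset.univ.filter (fun i => c i < 0))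
        (fun i => a i / (- c i)) ⟨j, by simp [hj]⟩
      simp only [Finset.mem_filter, Finset.mem_univ, true_and] at hk hkmin
      set t := a k / (- c k) with ht
      have ht0 : 0 ≤ t := div_nonneg (haQ.1.1 k) (by linarith)
      have hkz : a k + t * c k = 0 := by
        rw [ht]; field_simp [hk.ne]; ring
      have hnew : ∀ i, 0 ≤ a i + t * c i := by
        intro i
        rcases lt_or_ge (c i) 0 with h | h
        · have := hkmin i h
          rw [le_div_iff₀ (by linarith)] at this
          linarith
        · have := haQ.1.1 i
          positivity
      have hbQ : (fun i => a i + t * c i) ∈ Q := by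
        refine ⟨⟨hnew, hadd t⟩, fun a' ha' => ?_⟩
        have h1 := haQ.2 a' ha'
        have h2 := hsum t
        have h3 := mul_nonneg ht0 hs
        linarith
      have hlt : (Finset.univ.filter (fun i => a i + t * c i ≠ 0)).card <
          (Finset.univ.filter (fun i => a i ≠ 0)).card := by
        apply Finset.card_lt_card
        refine ⟨fun i hi => ?_, fun h => ?_⟩
        · simp only [Finset.mem_filter, Finset.mem_univ, true_and] at hi ⊢
          intro h0
          exact hi (by rw [h0, hc i h0]; simp)
        · have hka : k ∈ Finset.univ.filter (fun i => a i ≠ 0) := by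
            simp only [Finset.mem_filter, Finset.mem_univ, true_and]
            intro h0
            have := hc k h0
            linarith
          have := h hka
          simp only [Finset.mem_filter, Finset.mem_univ, true_and] at this
          exact this hkz
      have := hmin hbQ hlt.le
      exact absurd this (not_le.mpr hlt)
    have h1 := haQ.2 (fun i => a i + 1 * c i)
      ⟨fun i => by have := haQ.1.1 i; have := hnn i; positivity, hadd 1⟩
    have h2 := hsum 1
    have h3 : ∑ i, c i = 0 := by linarith
    rw [Finset.sum_eq_zero_iff_of_nonneg (fun i _ => hnn i)] at h3
    ext i
    exact h3 i (Finset.mem_univ i)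
  refine ⟨a, haQ.1.1, haQ.1.2, fun a' h h' => haQ.2 a' ⟨h, h'⟩, ?_⟩
  rw [Fintype.linearIndependent_iff]
  intro c hc i
  let c' : ι → ℝ := fun i => if h : a i ≠ 0 then c ⟨i, h⟩ else 0
  have hc'0 : ∀ i, a i = 0 → c' i = 0 := fun i h => by simp [c', h]
  have hc' : ∑ i, c' i • v i = 0 := by
    rw [← hc]
    have e : ∀ i : {i // a i ≠ 0}, c i • v i = c' i • v i := fun i => by simp [c', i.2]
    simp only [e]
    rw [← Finset.sum_subtype (p := fun i => a i ≠ 0) (Finset.univ.filter (fun i => a i ≠ 0))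
      (by simp) (fun i => c' i • v i), Finset.sum_filter]
    refine Finset.sum_congr rfl fun i _ => ?_
    split_ifs with h
    · rfl
    · rw [hc'0 i (not_not.mp h), zero_smul]
  have : c' = 0 := by
    rcases le_total 0 (∑ i, c' i) with h | h
    · exact key c' hc'0 hc' h
    · have := key (-c') (fun i h => by simp [hc'0 i h])
        (by simpa using hc') (by simpa using h)
      simpa using this
  have h := congrFun this i
  simpa [c', i.2] using h

theorem conf_iff {n : ℕ} (x y : Fin n → ℤ) :
    ConformalLE x y ↔ ∀ i, (0 ≤ x i ∧ x i ≤ y i) ∨ (y i ≤ x i ∧ x i ≤ 0) := by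
  refine forall_congr' fun i => ?_
  constructor
  · rintro ⟨h1, h2⟩
    rcases le_total 0 (y i) with hy | hy
    · rw [abs_of_nonneg hy] at h2
      rcases lt_or_ge (x i) 0 with hx | hx
      · have : y i = 0 := by nlinarith
        rw [this] at h2
        have := abs_nonpos_iff.mp h2
        omega
      · rw [abs_of_nonneg hx] at h2; omega
    · rw [abs_of_nonpos hy] at h2
      rcases lt_or_ge 0 (x i) with hx | hx
      · have : y i = 0 := by nlinarith
        rw [this] at h2
        have := abs_nonpos_iff.mp (h2.trans_eq neg_zero)
        omega
      · rw [abs_of_nonpos hx] at h2; omega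
  · rintro (⟨h1, h2⟩ | ⟨h1, h2⟩)
    · exact ⟨mul_nonneg h1 (h1.trans h2), by rwa [abs_of_nonneg h1, abs_of_nonneg (h1.trans h2)]⟩
    · exact ⟨mul_nonneg_of_nonpos_of_nonpos h2 (h1.trans h2),
        by rw [abs_of_nonpos h2, abs_of_nonpos (h1.trans h2)]; omega⟩

theorem conf_trans {n : ℕ} {x y z : Fin n → ℤ} (h1 : ConformalLE x y) (h2 : ConformalLE y z) :
    ConformalLE x z := by
  rw [conf_iff] at *
  intro i
  have := h1 i
  have := h2 i
  omega

theorem conf_sub {n : ℕ} {x y : Fin n → ℤ} (h1 : ConformalLE x y) : ConformalLE (y - x) y := by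
  rw [conf_iff] at *
  intro i
  have := h1 i
  simp only [Pi.sub_apply]
  omega

theorem conf_l1 {n : ℕ} {x y : Fin n → ℤ} (h1 : ConformalLE x y) :
    ∑ i, |y i - x i| = ∑ i, |y i| - ∑ i, |x i| := by
  rw [conf_iff] at h1
  rw [← Finset.sum_sub_distrib]
  refine Finset.sum_congr rfl fun i _ => ?_
  rcases h1 i with ⟨h, h'⟩ | ⟨h, h'⟩
  · rw [abs_of_nonneg h, abs_of_nonneg (h.trans h'), abs_of_nonneg (by omega)]
  · rw [abs_of_nonpos h', abs_of_nonpos (h.trans h'), abs_of_nonpos (by omega)]; omega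

theorem l1_pos {n : ℕ} {x : Fin n → ℤ} (h : x ≠ 0) : 0 < ∑ i, |x i| := by
  obtain ⟨i, hi⟩ := Function.ne_iff.mp h
  exact Finset.sum_pos' (fun i _ => abs_nonneg _) ⟨i, Finset.mem_univ i, abs_pos.mpr hi⟩

theorem exists_graver {m n : ℕ} (A : Matrix (Fin m) (Fin n) ℤ) (N : ℕ) :
    ∀ x : Fin n → ℤ, (∑ i, |x i|) ≤ N → A.mulVec x = 0 → x ≠ 0 →
      ∃ g ∈ GraverBasis A, ConformalLE g x := by
  induction N with
  | zero => intro x h _ hx; have := l1_pos hx; push_cast at h; omega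
  | succ N ih =>
    intro x hN hA hx
    by_cases hg : ∀ h : Fin n → ℤ, A.mulVec h = 0 → h ≠ 0 → ConformalLE h x → h = x
    · exact ⟨x, ⟨hA, hx, hg⟩, by rw [conf_iff]; intro i; omega⟩
    · push Not at hg
      obtain ⟨h, h1, h2, h3, h4⟩ := hg
      have e := conf_l1 h3
      have := l1_pos (sub_ne_zero.mpr (Ne.symm h4))
      simp only [Pi.sub_apply] at this
      obtain ⟨g, hg, hgh⟩ := ih h (by push_cast at hN; omega) h1 h2
      exact ⟨g, hg, conf_trans hgh h3⟩

theorem decomp {m n : ℕ} (A : Matrix (Fin m) (Fin n) ℤ) (d : Fin n → ℤ)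
    [Fintype {g // g ∈ GraverBasis A ∧ ConformalLE g d}] (N : ℕ) :
    ∀ x : Fin n → ℤ, (∑ i, |x i|) ≤ N → A.mulVec x = 0 → ConformalLE x d →
      ∃ c : {g // g ∈ GraverBasis A ∧ ConformalLE g d} → ℤ, (∀ g, 0 ≤ c g) ∧
        ∑ g, c g • g.1 = x := by
  classical
  induction N with
  | zero =>
    intro x h _ _
    have : x = 0 := by
      by_contra hx; have := l1_pos hx; push_cast at h; omega
    exact ⟨0, by simp, by simp [this]⟩
  | succ N ih =>
    intro x hN hA hxd
    by_cases hx : x = 0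
    · exact ⟨0, by simp, by simp [hx]⟩
    obtain ⟨g, hg, hgx⟩ := exists_graver A (N+1) x hN hA hx
    have e := conf_l1 hgx
    have := l1_pos hg.2.1
    obtain ⟨c, hc, hcs⟩ := ih (x - g) (by simp only [Pi.sub_apply]; push_cast at hN; omega)
      (by rw [Matrix.mulVec_sub, hA, hg.1, sub_zero]) (conf_trans (conf_sub hgx) hxd)
    refine ⟨c + Pi.single ⟨g, hg, conf_trans hgx hxd⟩ 1, fun g' => ?_, ?_⟩
    · have : (0 : {g // g ∈ GraverBasis A ∧ ConformalLE g d} → ℤ) ≤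
        Pi.single ⟨g, hg, conf_trans hgx hxd⟩ 1 := Pi.single_nonneg.mpr zero_le_one
      exact add_nonneg (hc g') (this g')
    · simp only [Pi.add_apply, add_smul, Finset.sum_add_distrib, hcs]
      rw [Finset.sum_eq_single ⟨g, hg, conf_trans hgx hxd⟩]
      · simp
      · intro b _ hb; simp [Pi.single_eq_of_ne hb]
      · simp

/-- Each Graver-element part of a conformal sum is bounded. -/
theorem key_avg {m n : ℕ} (hn : 2 ≤ n) (A : Matrix (Fin m) (Fin n) ℤ) (w d : Fin n → ℤ)
    (hd : A.mulVec d = 0) (D : ℤ) (hD : 0 ≤ D)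
    (H : ∀ g ∈ GraverBasis A, ∀ c : ℤ, ConformalLE (c • g) d → -D ≤ c * ∑ i, w i * g i) :
    -((2 * n - 2) * D) ≤ ∑ i, w i * d i := by
  classical
  by_cases hA : A = 0
  · subst hA
    have h1 : ∀ i, -D ≤ w i * d i := by
      intro i
      have := H (Pi.single i 1) ⟨Matrix.zero_mulVec _, by simp, ?_⟩ (d i) ?_
      · simpa [Pi.single_apply, mul_comm] using this
      · intro h _ h0 hc
        rw [conf_iff] at hc
        have hz : ∀ j, j ≠ i → h j = 0 := by
          intro j hj
          have := hc j
          rw [Pi.single_eq_of_ne hj] at this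
          omega
        have hi := hc i
        rw [Pi.single_eq_same] at hi
        have : h i ≠ 0 := by
          intro h'
          apply h0
          ext j
          by_cases hj : j = i
          · rw [hj, h']; rfl
          · exact hz j hj
        ext j
        by_cases hj : j = i
        · subst hj; rw [Pi.single_eq_same]; omega
        · rw [hz j hj, Pi.single_eq_of_ne hj]
      · rw [conf_iff]
        intro j
        by_cases hj : j = i
        · subst hj; simp; omega
        · simp [Pi.single_eq_of_ne hj]; omega
    have h2 : ∑ i : Fin n, -D ≤ ∑ i, w i * d i := Finset.sum_le_sum fun i _ => h1 i
    simp at h2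
    have : (2:ℤ) ≤ n := by exact_mod_cast hn
    nlinarith
  have hfin : Finite {g // g ∈ GraverBasis A ∧ ConformalLE g d} := by
    have : (Set.Icc (fun i => -|d i|) (fun i => |d i|)).Finite := Set.finite_Icc _ _
    refine (this.subset (t := {g | g ∈ GraverBasis A ∧ ConformalLE g d}) ?_).to_subtype
    rintro g ⟨_, hg⟩
    exact ⟨fun i => (abs_le.mp (hg i).2).1, fun i => (abs_le.mp (hg i).2).2⟩
  have := Fintype.ofFinite {g // g ∈ GraverBasis A ∧ ConformalLE g d}
  set ι := {g // g ∈ GraverBasis A ∧ ConformalLE g d} with hι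
  let v : ι → Fin n → ℝ := fun g i => (g.1 i : ℝ)
  have hconf : ∀ (g : ι) i, (0 ≤ g.1 i ∧ g.1 i ≤ d i) ∨ (d i ≤ g.1 i ∧ g.1 i ≤ 0) :=
    fun g => (conf_iff _ _).mp g.2.2
  -- partial sums are conformal
  have part : ∀ a a' : ι → ℝ, (∀ g, 0 ≤ a' g) → (∀ g, a' g ≤ a g) →
      ∑ g, a g • v g = (fun i => (d i : ℝ)) → ∀ i,
      (0 ≤ ∑ g, a' g * v g i ∧ ∑ g, a' g * v g i ≤ d i) ∨
      (d i ≤ ∑ g, a' g * v g i ∧ ∑ g, a' g * v g i ≤ 0) := by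
    intro a a' h0 hle hs i
    have hsi : ∑ g, a g * v g i = d i := by
      have := congrFun hs i
      simpa using this
    rw [← hsi]
    rcases le_total 0 (d i) with h | h
    · have hv : ∀ g, 0 ≤ v g i := by
        intro g
        have := hconf g i
        have : 0 ≤ g.1 i := by omega
        exact Int.cast_nonneg this
      exact Or.inl ⟨Finset.sum_nonneg fun g _ => mul_nonneg (h0 g) (hv g),
        Finset.sum_le_sum fun g _ => mul_le_mul_of_nonneg_right (hle g) (hv g)⟩
    · have hv : ∀ g, v g i ≤ 0 := by
        intro g
        have := hconf g i
        have : g.1 i ≤ 0 := by omega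
        exact Int.cast_nonpos.mpr this
      exact Or.inr ⟨Finset.sum_le_sum fun g _ => mul_le_mul_of_nonpos_right (hle g) (hv g),
        Finset.sum_nonpos fun g _ => mul_nonpos_of_nonneg_of_nonpos (h0 g) (hv g)⟩
  have castsum : ∀ (c : ι → ℤ) (x : Fin n → ℤ), ∑ g, c g • g.1 = x →
      ∑ g, ((c g : ℤ) : ℝ) • v g = fun i => (x i : ℝ) := by
    intro c x h
    subst h
    ext i
    simp [v]
  have hdec : ∀ x : Fin n → ℤ, A.mulVec x = 0 → ConformalLE x d →
      ∃ c : ι → ℤ, (∀ g, 0 ≤ c g) ∧ ∑ g : ι, c g • g.1 = x := fun x =>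
    decomp A d (∑ i, |x i|).toNat x
      (by rw [Int.toNat_of_nonneg (Finset.sum_nonneg fun i _ => abs_nonneg _)])
  obtain ⟨c0, hc0, hc0s⟩ := hdec d
    hd
    (by rw [conf_iff]; intro i; omega)
  obtain ⟨a, ha0, has, hamax, hali⟩ := lp_vertex v (fun i => (d i : ℝ)) (∑ i, |(d i : ℝ)|)
    ⟨fun g => c0 g, fun g => Int.cast_nonneg (hc0 g), castsum c0 d hc0s⟩ (by
      intro a ha hs g
      obtain ⟨i, hi⟩ := Function.ne_iff.mp g.2.1.2.1
      have hp := part a (Pi.single g (a g)) (fun g' => by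
        by_cases h : g' = g
        · subst h; simp [ha]
        · simp [h]) (fun g' => by
        by_cases h : g' = g
        · subst h; simp
        · simp [h, ha]) hs i
      have e : ∑ g', (Pi.single g (a g) : ι → ℝ) g' * v g' i = a g * v g i := by
        rw [Finset.sum_eq_single g] <;> simp +contextual
      rw [e] at hp
      have h1 : |a g * v g i| ≤ |(d i : ℝ)| := by
        rcases hp with ⟨h, h'⟩ | ⟨h, h'⟩
        · rwa [abs_of_nonneg h, abs_of_nonneg (h.trans h')]
        · rw [abs_of_nonpos h', abs_of_nonpos (h.trans h')]; linarith
      have h2 : (1:ℝ) ≤ |v g i| := by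
        have : 1 ≤ |g.1 i| := Int.one_le_abs hi
        have h3 : ((1:ℤ):ℝ) ≤ ((|g.1 i| : ℤ) : ℝ) := Int.cast_le.mpr this
        simpa [v] using h3
      rw [abs_mul, abs_of_nonneg (ha g)] at h1
      have h3 : |(d i : ℝ)| ≤ ∑ i, |(d i : ℝ)| :=
        Finset.single_le_sum (f := fun i => |(d i : ℝ)|) (fun i _ => abs_nonneg _) (Finset.mem_univ i)
      nlinarith [ha g])
  -- support size
  set T := Finset.univ.filter (fun g : ι => a g ≠ 0) with hT
  have hcard : T.card + 1 ≤ n := by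
    let L := (A.map (Int.cast : ℤ → ℝ)).mulVecLin
    have hv : ∀ g : ι, v g ∈ LinearMap.ker L := by
      intro g
      rw [LinearMap.mem_ker]
      ext j
      have := congrFun g.2.1.1 j
      simp only [Matrix.mulVec, dotProduct, Pi.zero_apply] at this
      simp only [L, Matrix.mulVecLin_apply, Matrix.mulVec, dotProduct, Matrix.map_apply, v, Pi.zero_apply]
      exact_mod_cast this
    have hlt : Module.finrank ℝ (LinearMap.ker L) < n := by
      have := Submodule.finrank_lt (s := LinearMap.ker L) (by
        intro htop
        apply hA
        rw [LinearMap.ker_eq_top] at htop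
        ext j k
        have := congrFun (LinearMap.congr_fun htop (Pi.single k 1)) j
        simp [L] at this
        simpa using this)
      simpa using this
    have hli : LinearIndependent ℝ (fun i : {i // a i ≠ 0} => (⟨v i, hv i⟩ : LinearMap.ker L)) := by
      apply LinearIndependent.of_comp (LinearMap.ker L).subtype
      exact hali
    have := hli.fintype_card_le_finrank
    rw [Fintype.card_subtype] at this
    have e : T.card = (Finset.univ.filter (fun g : ι => a g ≠ 0)).card := rfl
    have e' : T.card ≤ Module.finrank ℝ (LinearMap.ker L) := by
      convert this
    omega
  -- the remainder
  let r : Fin n → ℤ := d - ∑ g, ⌊a g⌋ • g.1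
  have hr : ∀ i, (r i : ℝ) = ∑ g, Int.fract (a g) * v g i := by
    intro i
    have := congrFun has i
    simp only [Finset.sum_apply, Pi.smul_apply, smul_eq_mul] at this
    simp only [r, Pi.sub_apply, Finset.sum_apply, Pi.smul_apply, smul_eq_mul]
    push_cast
    rw [← this, ← Finset.sum_sub_distrib]
    refine Finset.sum_congr rfl fun g _ => ?_
    simp only [Int.fract, v]; ring
  have hrd : ConformalLE r d := by
    rw [conf_iff]
    intro i
    have := part a (fun g => Int.fract (a g)) (fun g => Int.fract_nonneg _)
      (fun g => by
        have : (0:ℝ) ≤ ⌊a g⌋ := by exact_mod_cast Int.floor_nonneg.mpr (ha0 g)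
        simp only [Int.fract]; linarith) has i
    rw [← hr i] at this
    exact_mod_cast this
  have hrA : A.mulVec r = 0 := by
    simp only [r, Matrix.mulVec_sub, hd, Matrix.mulVec_sum, Matrix.mulVec_smul]
    simp [fun g : ι => g.2.1.1]
  obtain ⟨μ, hμ0, hμs⟩ := hdec r hrA hrd
  let c : ι → ℤ := fun g => ⌊a g⌋ + μ g
  have hc0 : ∀ g, 0 ≤ c g := fun g => add_nonneg (Int.floor_nonneg.mpr (ha0 g)) (hμ0 g)
  have hcs : ∑ g, c g • g.1 = d := by
    simp only [c, add_smul, Finset.sum_add_distrib, hμs, r]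
    abel
  have hmx := hamax (fun g => c g) (fun g => by exact_mod_cast hc0 g) (castsum c d hcs)
  have hμle : (∑ g, μ g : ℝ) ≤ ∑ g, Int.fract (a g) := by
    simp only [c] at hmx
    push_cast at hmx
    rw [Finset.sum_add_distrib] at hmx
    simp only [Int.fract, Finset.sum_sub_distrib]
    linarith
  have hfr : ∑ g, Int.fract (a g) ≤ T.card := by
    have : ∑ g, Int.fract (a g) ≤ ∑ g, (if a g ≠ 0 then (1:ℝ) else 0) := by
      refine Finset.sum_le_sum fun g _ => ?_
      split_ifs with h
      · exact (Int.fract_lt_one _).le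
      · simp only [ne_eq, not_not] at h; simp [h]
    rw [hT, Finset.card_filter]
    push_cast
    exact this
  have hμT : ∑ g, μ g ≤ T.card := by
    have := hμle.trans hfr
    exact_mod_cast this
  set U := Finset.univ.filter (fun g : ι => c g ≠ 0) with hU
  have hUc : (U.card : ℤ) ≤ T.card + ∑ g, μ g := by
    have e1 : (U.card : ℤ) = ∑ g, if c g ≠ 0 then 1 else 0 := by
      rw [hU, Finset.card_filter]; push_cast; rfl
    have e2 : (T.card : ℤ) = ∑ g, if a g ≠ 0 then 1 else 0 := by
      rw [hT, Finset.card_filter]; push_cast; rfl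
    rw [e1, e2, ← Finset.sum_add_distrib]
    refine Finset.sum_le_sum fun g _ => ?_
    have := hμ0 g
    by_cases h : a g = 0
    · have hcg : c g = μ g := by simp [c, h]
      rw [hcg, if_neg (not_not.mpr h)]
      split_ifs <;> omega
    · rw [if_pos h]
      split_ifs <;> omega
  have hterm : ∀ g, -D ≤ c g * ∑ i, w i * g.1 i := by
    intro g
    apply H g.1 g.2.1
    rw [conf_iff]
    intro i
    have hp := part (fun g => c g) (Pi.single g (c g : ℝ)) (fun g' => by
        by_cases h : g' = g
        · subst h; simp [hc0]
        · simp [h]) (fun g' => by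
        by_cases h : g' = g
        · subst h; simp
        · simp [h, hc0]) (castsum c d hcs) i
    have e : ∑ g', (Pi.single g (c g : ℝ) : ι → ℝ) g' * v g' i = ((c g * g.1 i : ℤ) : ℝ) := by
      rw [Finset.sum_eq_single g] <;> simp +contextual [v]
    rw [e] at hp
    simp only [Pi.smul_apply, smul_eq_mul]
    exact_mod_cast hp
  have hwd : ∑ i, w i * d i = ∑ g, c g * ∑ i, w i * g.1 i := by
    conv_lhs => rw [← hcs]
    simp only [Finset.sum_apply, Pi.smul_apply, smul_eq_mul, Finset.mul_sum]
    rw [Finset.sum_comm]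
    refine Finset.sum_congr rfl fun g _ => Finset.sum_congr rfl fun i _ => by ring
  have hlow : -(U.card * D) ≤ ∑ g, c g * ∑ i, w i * g.1 i := by
    have e : -(U.card * D) = ∑ g, if c g ≠ 0 then -D else 0 := by
      rw [← Finset.sum_filter]; simp [hU]
    rw [e]
    refine Finset.sum_le_sum fun g _ => ?_
    split_ifs with h
    · exact hterm g
    · simp only [ne_eq, not_not] at h; simp [h]
  rw [hwd]
  have : (U.card : ℤ) ≤ 2 * n - 2 := by omega
  nlinarith

theorem feas_step {m n : ℕ} (A : Matrix (Fin m) (Fin n) ℤ) (b : Fin m → ℤ)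
    (l u : Fin n → EReal) (x y h : Fin n → ℤ) (hx : Feasible A b l u x) (hy : Feasible A b l u y)
    (hA : A.mulVec h = 0) (hc : ConformalLE h (y - x)) : Feasible A b l u (x + h) := by
  refine ⟨by rw [Matrix.mulVec_add, hx.1, hA, add_zero], fun i => ?_⟩
  rw [conf_iff] at hc
  have mono : ∀ p q : ℤ, p ≤ q → ((p : ℝ) : EReal) ≤ ((q : ℝ) : EReal) := fun p q h => by
    exact_mod_cast h
  have hi := hc i
  simp only [Pi.sub_apply] at hi
  simp only [Pi.add_apply]
  rcases hi with hi | hi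
  · exact ⟨(hx.2 i).1.trans (mono _ _ (by omega)), (mono _ _ (by omega)).trans (hy.2 i).2⟩
  · exact ⟨(hy.2 i).1.trans (mono _ _ (by omega)), (mono _ _ (by omega)).trans (hx.2 i).2⟩

/-- The Graver-best augmentation procedure: each Graver-best step shrinks the
optimality gap by a factor of at least `1 - 1/(2n-2)`, and consequently the
procedure started at a feasible `x₀` reaches the optimum after at most
`(2n - 2) log F` steps, where `F = w x₀ - w x*` and `x*` is any minimizer. -/
theorem graver_best_augmentation_convergence {m n : ℕ} (hn : 2 ≤ n)
    (A : Matrix (Fin m) (Fin n) ℤ) (w : Fin n → ℤ) (b : Fin m → ℤ)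
    (l u : Fin n → EReal) (xstar : Fin n → ℤ)
    (hstar : Feasible A b l u xstar ∧
      ∀ y, Feasible A b l u y → ∑ i, w i * xstar i ≤ ∑ i, w i * y i)
    (seq : ℕ → (Fin n → ℤ)) (h0 : Feasible A b l u (seq 0))
    (hstep : ∀ k,
      ((∀ y, Feasible A b l u y → ∑ i, w i * seq k i ≤ ∑ i, w i * y i) ∧
          seq (k + 1) = seq k) ∨
      GraverBestStep A w b l u (seq k) (seq (k + 1) - seq k)) :
    (∀ k : ℕ,
      ((∑ i, w i * seq (k + 1) i - ∑ i, w i * xstar i : ℤ) : ℝ) ≤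
        (1 - 1 / (2 * (n : ℝ) - 2)) *
          ((∑ i, w i * seq k i - ∑ i, w i * xstar i : ℤ) : ℝ)) ∧
    (∀ k : ℕ,
      (2 * (n : ℝ) - 2) *
          Real.log ((∑ i, w i * seq 0 i - ∑ i, w i * xstar i : ℤ) : ℝ) < (k : ℝ) →
        ∑ i, w i * seq k i = ∑ i, w i * xstar i) := by
  have hN : (2:ℝ) ≤ 2 * (n : ℝ) - 2 := by
    have : (2:ℝ) ≤ n := by exact_mod_cast hn
    linarith
  have hfeas : ∀ k, Feasible A b l u (seq k) := by
    intro k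
    induction k with
    | zero => exact h0
    | succ k ih =>
      rcases hstep k with ⟨_, h⟩ | h
      · rw [h]; exact ih
      · have := h.1
        rwa [add_sub_cancel] at this
  have hfirst : ∀ k : ℕ,
      ((∑ i, w i * seq (k + 1) i - ∑ i, w i * xstar i : ℤ) : ℝ) ≤
        (1 - 1 / (2 * (n : ℝ) - 2)) *
          ((∑ i, w i * seq k i - ∑ i, w i * xstar i : ℤ) : ℝ) := by
    intro k
    rcases hstep k with ⟨h, h'⟩ | ⟨h1, h2, h3⟩
    · have e : ∑ i, w i * seq k i = ∑ i, w i * xstar i :=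
        le_antisymm (h _ hstar.1) (hstar.2 _ (hfeas k))
      rw [h', e]; simp
    · rw [add_sub_cancel] at h1 h2
      simp only [add_sub_cancel] at h3
      have hk := key_avg hn A w (xstar - seq k)
        (by rw [Matrix.mulVec_sub, hstar.1.1, (hfeas k).1, sub_self])
        (∑ i, w i * seq k i - ∑ i, w i * seq (k+1) i) (by linarith) (by
          intro g hg c hc
          have := h3 g hg c (feas_step A b l u _ _ _ (hfeas k) hstar.1
            (by rw [Matrix.mulVec_smul, hg.1, smul_zero]) hc)
          have e : ∑ i, w i * (seq k + c • g) i = ∑ i, w i * seq k i + c * ∑ i, w i * g i := by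
            rw [Finset.mul_sum, ← Finset.sum_add_distrib]
            refine Finset.sum_congr rfl fun i _ => ?_
            simp only [Pi.add_apply, Pi.smul_apply, smul_eq_mul]; ring
          rw [e] at this
          linarith)
      simp only [Pi.sub_apply, mul_sub, Finset.sum_sub_distrib] at hk
      generalize ∑ i, w i * seq k i = p at *
      generalize ∑ i, w i * seq (k+1) i = q at *
      generalize ∑ i, w i * xstar i = s at *
      have hk' : -((2 * (n:ℝ) - 2) * ((p:ℝ) - q)) ≤ s - p := by
        have : ((-((2 * (n:ℤ) - 2) * (p - q)) : ℤ) : ℝ) ≤ ((s - p : ℤ) : ℝ) :=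
          Int.cast_le.mpr (by linarith)
        push_cast at this
        exact this
      push_cast
      have h4 : ((p:ℝ) - s) / (2 * (n:ℝ) - 2) ≤ p - q := by
        rw [div_le_iff₀ (by linarith)]; linarith
      have h5 : (1 - 1 / (2 * (n : ℝ) - 2)) * ((p:ℝ) - s) = (p - s) - (p - s) / (2 * (n:ℝ) - 2) := by
        ring
      rw [h5]; linarith
  refine ⟨hfirst, fun k hk => ?_⟩
  have hq0 : 0 ≤ 1 - 1 / (2 * (n : ℝ) - 2) := by
    have : 1 / (2 * (n : ℝ) - 2) ≤ 1 := by
      rw [div_le_one (by linarith)]; linarith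
    linarith
  have hpow : ∀ k : ℕ, ((∑ i, w i * seq k i - ∑ i, w i * xstar i : ℤ) : ℝ) ≤
      (1 - 1 / (2 * (n : ℝ) - 2)) ^ k *
        ((∑ i, w i * seq 0 i - ∑ i, w i * xstar i : ℤ) : ℝ) := by
    intro k
    induction k with
    | zero => simp
    | succ k ih =>
      refine (hfirst k).trans ?_
      rw [pow_succ', mul_assoc]
      exact mul_le_mul_of_nonneg_left ih hq0
  have hk2 := hpow k
  have hopt := hstar.2 _ (hfeas k)
  have hopt0 := hstar.2 _ (hfeas 0)
  generalize hF : ∑ i, w i * seq 0 i - ∑ i, w i * xstar i = F at *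
  suffices hlt : ((∑ i, w i * seq k i - ∑ i, w i * xstar i : ℤ) : ℝ) < 1 by
    have : (∑ i, w i * seq k i - ∑ i, w i * xstar i : ℤ) < 1 := by exact_mod_cast hlt
    omega
  refine hk2.trans_lt ?_
  rcases (show 0 ≤ F by omega).eq_or_lt with h | h
  · rw [← h]; simp
  · have hFp : (0:ℝ) < F := by exact_mod_cast h
    have e1 : (1 - 1 / (2 * (n : ℝ) - 2)) ^ k ≤ Real.exp (-(k / (2 * (n : ℝ) - 2))) := by
      have := pow_le_pow_left₀ hq0 (Real.one_sub_le_exp_neg (1 / (2 * (n : ℝ) - 2))) k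
      rw [← Real.exp_nat_mul] at this
      refine this.trans_eq ?_
      congr 1; ring
    have e2 : Real.log F < k / (2 * (n : ℝ) - 2) := by
      rw [lt_div_iff₀ (by linarith)]; linarith
    calc _ ≤ Real.exp (-(k / (2 * (n : ℝ) - 2))) * F := mul_le_mul_of_nonneg_right e1 hFp.le
      _ = Real.exp (-(k / (2 * (n : ℝ) - 2)) + Real.log F) := by
        rw [Real.exp_add, Real.exp_log hFp]
      _ < 1 := by rw [Real.exp_lt_one_iff]; linarith
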